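/- arXiv:2605.22063 — 2 statements merged into one kernel-verified Lean document; each statement's English description precedes it below -/
import Mathlib

section
/- Let p be a prime, Λ = ℤ_p[[T]] the power series ring over the p-adic integers, and for j ≥ 0 let P_j = Φ_{p^j}(1+T) ∈ Λ be the image of the p^j-th cyclotomic polynomial under X ↦ 1+T. Let n ≥ 0 and let e_0, …, e_n be nonnegative integers. Suppose M is a finitely generated Λ-module admitting a Λ-module homomorphism M → ⊕_{j=0}^{n} (Λ/(P_j))^{e_j} with finite kernel and finite cokernel, and let π : M → Q be a surjective Λ-module homomorphism. Then there exist nonnegative integers s_0, …, s_n with s_j ≤ e_j for all j, and a Λ-module homomorphism Q → ⊕_{j=0}^{n} (Λ/(P_j))^{s_j} with finite kernel and finite cokernel. -/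
set_option synthInstance.maxHeartbeats 1000000
set_option maxHeartbeats 1000000

open Polynomial in
theorem cyclotomic_prime_pow_comp_one_add_X_prime_and_isDistinguishedAt (p : ℕ) [Fact p.Prime]
    (j : ℕ) :
    Prime ((cyclotomic (p ^ j) ℤ_[p]).comp (1 + X)) ∧
      ((cyclotomic (p ^ j) ℤ_[p]).comp (1 + X)).IsDistinguishedAt
        (IsLocalRing.maximalIdeal ℤ_[p]) := by
  have hmonic : ((cyclotomic (p ^ j) ℤ_[p]).comp (1 + X)).Monic := by
    rw [add_comm, ← C_1]
    exact (cyclotomic.monic _ _).comp (monic_X_add_C 1) (by rw [natDegree_X_add_C]; exact one_ne_zero)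
  rcases j with _ | j
  · have h : (cyclotomic (p ^ 0) ℤ_[p]).comp (1 + X) = X := by simp
    rw [h]
    refine ⟨prime_X, ⟨⟨fun {i} hi => ?_⟩, monic_X⟩⟩
    rw [natDegree_X, Nat.lt_one_iff] at hi
    simp [hi]
  · have hp : (p : ℤ_[p]) ∈ IsLocalRing.maximalIdeal ℤ_[p] := by
      rw [PadicInt.maximalIdeal_eq_span_p]; exact Ideal.mem_span_singleton_self _
    have hE := (cyclotomic_prime_pow_comp_X_add_one_isEisensteinAt p j).isWeaklyEisensteinAt.map
      (Int.castRingHom ℤ_[p])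
    have hmap : ((cyclotomic (p ^ (j + 1)) ℤ).comp (X + 1)).map (Int.castRingHom ℤ_[p]) =
        (cyclotomic (p ^ (j + 1)) ℤ_[p]).comp (1 + X) := by
      rw [map_comp, map_cyclotomic]; simp [add_comm]
    have hmem : ∀ {i}, i < ((cyclotomic (p ^ (j + 1)) ℤ_[p]).comp (1 + X)).natDegree →
        ((cyclotomic (p ^ (j + 1)) ℤ_[p]).comp (1 + X)).coeff i ∈
          IsLocalRing.maximalIdeal ℤ_[p] := by
      rw [hmap] at hE
      intro i hi
      have := hE.mem hi
      rw [PadicInt.maximalIdeal_eq_span_p]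
      simpa [Ideal.map_span] using this
    refine ⟨?_, ⟨⟨hmem⟩, hmonic⟩⟩
    rw [← irreducible_iff_prime]
    have hcoeff : ((cyclotomic (p ^ (j + 1)) ℤ_[p]).comp (1 + X)).coeff 0 = p := by
      rw [coeff_zero_eq_eval_zero, eval_comp]
      simp
    have hdeg : 0 < ((cyclotomic (p ^ (j + 1)) ℤ_[p]).comp (1 + X)).natDegree := by
      rw [natDegree_comp, natDegree_cyclotomic, add_comm 1 X, ← C_1, natDegree_X_add_C, mul_one]
      exact Nat.totient_pos.2 (pow_pos (Nat.Prime.pos Fact.out) _)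
    refine (hmonic.isEisensteinAt_of_mem_of_notMem (Ideal.IsPrime.ne_top inferInstance)
      hmem ?_).irreducible inferInstance hmonic.isPrimitive hdeg
    rw [hcoeff, PadicInt.maximalIdeal_eq_span_p, Ideal.span_singleton_pow,
      Ideal.mem_span_singleton]
    intro h
    have hp0 : (p : ℤ_[p]) ≠ 0 := Nat.cast_ne_zero.2 (Nat.Prime.ne_zero Fact.out)
    have := (pow_dvd_pow_iff hp0 PadicInt.prime_p.not_isUnit (n := 2) (m := 1)).1 (by simpa using h)
    omega

theorem coe_comp_one_add_X {R : Type*} [CommRing R] (f : Polynomial R) :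
    ((f.comp (1 + Polynomial.X) : Polynomial R) : PowerSeries R) =
      Polynomial.aeval (1 + PowerSeries.X : PowerSeries R) f := by
  have h := Polynomial.aeval_algHom_apply (Polynomial.coeToPowerSeries.algHom (R := R) R)
    (1 + Polynomial.X) f
  simpa [Polynomial.comp_eq_aeval] using h.symm

theorem isPrime_and_finite_quotient_span_aeval_cyclotomic (p : ℕ) [Fact p.Prime] (j : ℕ) :
    (Ideal.span {Polynomial.aeval (1 + PowerSeries.X : PowerSeries ℤ_[p])
      (Polynomial.cyclotomic (p ^ j) ℤ_[p])}).IsPrime ∧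
    Module.Finite ℤ_[p] (PowerSeries ℤ_[p] ⧸ Ideal.span {Polynomial.aeval
      (1 + PowerSeries.X : PowerSeries ℤ_[p]) (Polynomial.cyclotomic (p ^ j) ℤ_[p])}) := by
  obtain ⟨hprime, hdist⟩ := cyclotomic_prime_pow_comp_one_add_X_prime_and_isDistinguishedAt p j
  rw [← coe_comp_one_add_X]
  have := hdist.monic.finite_quotient
  have := (Ideal.span_singleton_prime hprime.ne_zero).2 hprime
  have e := hdist.algEquivQuotient
  exact ⟨(Ideal.Quotient.isDomain_iff_prime _).1 (MulEquiv.isDomain _ e.symm.toMulEquiv),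
    Module.Finite.equiv e.toLinearEquiv⟩

instance (p : ℕ) [Fact p.Prime] : Ring.HasFiniteQuotients ℤ_[p] where
  finiteQuotient {I} hI := by
    obtain ⟨n, rfl⟩ := PadicInt.ideal_eq_span_pow_p hI
    have : NeZero (p ^ n) := ⟨pow_ne_zero _ (Nat.Prime.ne_zero Fact.out)⟩
    rw [← PadicInt.ker_toZModPow]
    exact Finite.of_injective _ (RingHom.kerLift_injective (PadicInt.toZModPow (p := p) n))

theorem Module.finite_of_smul_eq_zero {R X : Type*} [CommRing R] [Ring.HasFiniteQuotients R]
    [AddCommGroup X] [Module R X] [Module.Finite R X] {r : R} (hr : r ≠ 0)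
    (h : ∀ x : X, r • x = 0) : Finite X := by
  have hann : Module.annihilator R X ≠ ⊥ :=
    fun hbot => hr (by simpa [hbot] using Module.mem_annihilator.2 h)
  have := Ring.HasFiniteQuotients.finiteQuotient hann
  let _ : Module (R ⧸ Module.annihilator R X) X := Module.quotientAnnihilator
  have : Module.Finite (R ⧸ Module.annihilator R X) X :=
    Module.Finite.of_restrictScalars_finite R _ _
  exact Module.finite_of_finite (R ⧸ Module.annihilator R X)

/-- The scalar `c` annihilates the kernel and the cokernel of `f`. -/
structure LinearMap.IsIsogenyBy {A M N : Type*} [CommRing A] [AddCommGroup M] [Module A M]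
    [AddCommGroup N] [Module A N] (f : M →ₗ[A] N) (c : A) : Prop where
  smul_eq_zero : ∀ x, f x = 0 → c • x = 0
  exists_eq_smul : ∀ y, ∃ x, f x = c • y

namespace LinearMap.IsIsogenyBy

variable {A M N : Type*} [CommRing A] [AddCommGroup M] [Module A M]
    [AddCommGroup N] [Module A N] {f : M →ₗ[A] N} {c : A}

theorem exists_isIsogenyBy (h : f.IsIsogenyBy c) :
    ∃ g : N →ₗ[A] M, g.IsIsogenyBy (c * c) := by
  have key : ∀ x x', f x = f x' → c • x = c • x' := fun x x' hx => by
    rw [← sub_eq_zero, ← smul_sub]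
    exact h.smul_eq_zero _ (by rw [map_sub, hx, sub_self])
  choose s hs using h.exists_eq_smul
  refine ⟨{ toFun := fun y => c • s y, map_add' := ?_, map_smul' := ?_ }, ⟨?_, ?_⟩⟩
  · intro y z
    rw [← smul_add]
    exact key _ _ (by rw [map_add, hs, hs, hs, smul_add])
  · intro a y
    rw [RingHom.id_apply, smul_comm a c]
    exact key _ _ (by rw [map_smul, hs, hs, smul_comm])
  · intro y hy
    have hy : c • s y = 0 := hy
    rw [mul_smul, ← hs y, ← map_smul, hy, map_zero]
  · intro x
    refine ⟨f x, ?_⟩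
    change c • s (f x) = _
    rw [mul_smul]
    exact key _ _ (by rw [hs, map_smul])

theorem finite_ker_and_coker {R : Type*} [CommRing R] [Ring.HasFiniteQuotients R] [Algebra R A]
    [Module R M] [IsScalarTower R A M] [Module.Finite R M]
    [Module R N] [IsScalarTower R A N] [Module.Finite R N]
    {r : R} (hr : r ≠ 0) (h : f.IsIsogenyBy (algebraMap R A r)) :
    Finite (LinearMap.ker f) ∧ Finite (N ⧸ LinearMap.range f) := by
  have : Module.Finite R (LinearMap.ker f) :=
    Module.IsNoetherian.finite R ((LinearMap.ker f).restrictScalars R)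
  have : Module.Finite R (N ⧸ LinearMap.range f) :=
    Module.Finite.of_surjective ((LinearMap.range f).mkQ.restrictScalars R)
      (LinearMap.range f).mkQ_surjective
  refine ⟨Module.finite_of_smul_eq_zero hr fun x => ?_,
    Module.finite_of_smul_eq_zero hr fun y => ?_⟩
  · ext
    simpa using h.smul_eq_zero x x.2
  · obtain ⟨y, rfl⟩ := (LinearMap.range f).mkQ_surjective y
    rw [← algebraMap_smul A r, ← map_smul]
    exact (Submodule.Quotient.mk_eq_zero _).2 (h.exists_eq_smul y)

theorem linearEquiv_comp {N' : Type*} [AddCommGroup N'] [Module A N'] (h : f.IsIsogenyBy c)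
    (e : N ≃ₗ[A] N') : (e.toLinearMap ∘ₗ f).IsIsogenyBy c where
  smul_eq_zero x hx := h.smul_eq_zero x (by simpa using hx)
  exists_eq_smul y := by
    obtain ⟨x, hx⟩ := h.exists_eq_smul (e.symm y)
    exact ⟨x, by simp [hx]⟩

theorem of_finite [Finite (LinearMap.ker f)] [Finite (N ⧸ LinearMap.range f)] :
    ∃ m : ℕ, m ≠ 0 ∧ f.IsIsogenyBy (m : A) := by
  refine ⟨Nat.card (LinearMap.ker f) * Nat.card (N ⧸ LinearMap.range f),
    mul_ne_zero Nat.card_pos.ne' Nat.card_pos.ne', fun x hx => ?_, fun y => ?_⟩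
  · have h : Nat.card (LinearMap.ker f) • (⟨x, hx⟩ : LinearMap.ker f) = 0 := card_nsmul_eq_zero'
    have h : Nat.card (LinearMap.ker f) • x = 0 := congrArg Subtype.val h
    rw [Nat.cast_smul_eq_nsmul, mul_comm, mul_smul, h, smul_zero]
  · have h : Nat.card (N ⧸ LinearMap.range f) • (LinearMap.range f).mkQ y = 0 :=
      card_nsmul_eq_zero'
    rw [← map_nsmul] at h
    have h := (Submodule.Quotient.mk_eq_zero _).1 h
    rw [Nat.cast_smul_eq_nsmul, mul_smul]
    exact (LinearMap.range f).smul_of_tower_mem _ h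

end LinearMap.IsIsogenyBy

theorem exists_mul_mk_eq_algebraMap {R A : Type*} [CommRing R] [Nontrivial R] [CommRing A]
    [Algebra R A] (I : Ideal A) [I.IsPrime] [Module.Finite R (A ⧸ I)] {x : A ⧸ I} (hx : x ≠ 0) :
    ∃ r : R, r ≠ 0 ∧ ∃ b : A, b • x = algebraMap R (A ⧸ I) r := by
  have h := Ideal.comap_ne_bot_of_integral_mem (R := R) hx (Ideal.mem_span_singleton_self x)
    (Algebra.IsIntegral.isIntegral x)
  obtain ⟨r, hr, hr0⟩ := Submodule.exists_mem_ne_zero_of_ne_bot h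
  obtain ⟨b, hb⟩ := Ideal.mem_span_singleton'.1 (Ideal.mem_comap.1 hr)
  obtain ⟨b, rfl⟩ := Ideal.Quotient.mk_surjective b
  exact ⟨r, hr0, b, by rw [← hb, Algebra.smul_def]; rfl⟩

/-- Functions supported in `S`. -/
abbrev Submodule.supportedIn {ι : Type*} (A : Type*) [CommRing A] (O : ι → Type*)
    [∀ i, AddCommGroup (O i)] [∀ i, Module A (O i)] (S : Set ι) : Submodule A (Π i, O i) :=
  Submodule.pi Sᶜ fun _ => ⊥

theorem exists_smul_single_mem_of_maximal {R A ι Q : Type*} [CommRing R] [Nontrivial R]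
    [CommRing A] [Algebra R A] [DecidableEq ι] (I : ι → Ideal A) [∀ i, (I i).IsPrime]
    [∀ i, Module.Finite R (A ⧸ I i)] [AddCommGroup Q] [Module A Q]
    (φ : (Π i, A ⧸ I i) →ₗ[A] Q) {S : Set ι}
    (hS : Maximal (fun S => Disjoint (LinearMap.ker φ)
      (Submodule.supportedIn A (fun i => A ⧸ I i) S)) S) (i : ι) :
    ∃ r : R, r ≠ 0 ∧ ∀ a : A ⧸ I i, algebraMap R A r • φ (Pi.single i a) ∈
      (Submodule.supportedIn A (fun i => A ⧸ I i) S).map φ := by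
  by_cases hi : i ∈ S
  · refine ⟨1, one_ne_zero, fun a => Submodule.smul_mem _ _ (Submodule.mem_map_of_mem ?_)⟩
    intro k hk
    have : k ≠ i := fun h => hk (h ▸ hi)
    simp [this]
  · have hnot := hS.not_prop_of_gt (Set.ssubset_insert hi)
    rw [Submodule.disjoint_def] at hnot
    push Not at hnot
    obtain ⟨x, hxker, hxS, hx0⟩ := hnot
    have hxi : x i ≠ 0 := by
      intro h
      refine hx0 (Submodule.disjoint_def.1 hS.prop x hxker fun k hk => ?_)
      by_cases hki : k = i
      · subst hki; simpa using h
      · exact hxS k (by simpa [hki] using hk)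
    obtain ⟨r, hr, b, hb⟩ := exists_mul_mk_eq_algebraMap (R := R) (I i) hxi
    refine ⟨r, hr, fun a => ?_⟩
    obtain ⟨a, rfl⟩ := Ideal.Quotient.mk_surjective a
    have hmem : a • (Pi.single i (b • x i) - b • x) ∈
        Submodule.supportedIn A (fun i => A ⧸ I i) S := by
      refine Submodule.smul_mem _ _ fun k hk => ?_
      by_cases hki : k = i
      · subst hki; simp
      · have : x k = 0 := hxS k (by simpa [hki] using hk)
        simp [hki, this]
    refine ⟨_, hmem, ?_⟩
    rw [map_smul, map_sub, map_smul, LinearMap.mem_ker.1 hxker, smul_zero, sub_zero, hb,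
      ← map_smul, ← map_smul, ← Pi.single_smul, ← Pi.single_smul]
    congr 2
    rw [Algebra.smul_def, Algebra.smul_def, mul_comm, ← IsScalarTower.algebraMap_apply]
    rfl

theorem exists_isIsogenyBy_supportedIn {R A ι Q : Type*} [CommRing R] [IsDomain R]
    [CommRing A] [Algebra R A] [Finite ι] (I : ι → Ideal A) [∀ i, (I i).IsPrime]
    [∀ i, Module.Finite R (A ⧸ I i)] [AddCommGroup Q] [Module A Q]
    (φ : (Π i, A ⧸ I i) →ₗ[A] Q) {c : R} (hc : c ≠ 0)
    (hφ : ∀ q, ∃ x, φ x = algebraMap R A c • q) :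
    ∃ S : Set ι, ∃ r : R, r ≠ 0 ∧
      ∃ g : Q →ₗ[A] Submodule.supportedIn A (fun i => A ⧸ I i) S,
        g.IsIsogenyBy (algebraMap R A r) := by
  classical
  have := Fintype.ofFinite ι
  obtain ⟨S, -, hS⟩ := Set.Finite.exists_le_maximal
    (Set.toFinite {S : Set ι | Disjoint (LinearMap.ker φ)
      (Submodule.supportedIn A (fun i => A ⧸ I i) S)}) (a := ∅)
    (Submodule.disjoint_def.2 fun x _ hx => by
      ext i
      simpa using hx i (by simp))
  choose r hr hrmem using exists_smul_single_mem_of_maximal (R := R) I φ hS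
  have hf : (φ.domRestrict (Submodule.supportedIn A (fun i => A ⧸ I i) S)).IsIsogenyBy
      (algebraMap R A ((∏ i, r i) * c)) := by
    refine ⟨fun x hx => ?_, fun q => ?_⟩
    · have : x = 0 := Subtype.ext (Submodule.disjoint_def.1 hS.prop x hx x.2)
      rw [this, smul_zero]
    · obtain ⟨x, hx⟩ := hφ q
      have hmem : algebraMap R A (∏ i, r i) • φ x ∈
          (Submodule.supportedIn A (fun i => A ⧸ I i) S).map φ := by
        rw [← Finset.univ_sum_single x, map_sum, Finset.smul_sum]
        refine Submodule.sum_mem _ fun i _ => ?_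
        rw [← Finset.prod_erase_mul _ _ (Finset.mem_univ i), map_mul, mul_smul]
        exact Submodule.smul_mem _ _ (hrmem i _)
      obtain ⟨y, hy, hyx⟩ := hmem
      exact ⟨⟨y, hy⟩, by rw [map_mul, mul_smul, ← hx, ← hyx]; rfl⟩
  obtain ⟨g, hg⟩ := hf.exists_isIsogenyBy
  exact ⟨S, _, mul_self_ne_zero.2 (mul_ne_zero (Finset.prod_ne_zero_iff.2 fun i _ => hr i) hc),
    g, by rwa [map_mul]⟩

/-- Functions on a finite sigma type supported in `S` are families indexed by the fibres
of `S`. -/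
theorem nonempty_supportedIn_sigma_linearEquiv {A J : Type*} [CommRing A] (O : J → Type*)
    [∀ j, AddCommGroup (O j)] [∀ j, Module A (O j)] {e : J → ℕ} (S : Set (Σ j, Fin (e j))) :
    Nonempty (Submodule.supportedIn A (fun i : Σ j, Fin (e j) => O i.1) S ≃ₗ[A]
      (Π j, Fin (Nat.card {k // (⟨j, k⟩ : Σ j, Fin (e j)) ∈ S}) → O j)) := by
  classical
  let ε := fun j => Finite.equivFin {k // (⟨j, k⟩ : Σ j, Fin (e j)) ∈ S}
  let F : Submodule.supportedIn A (fun i : Σ j, Fin (e j) => O i.1) S →ₗ[A]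
      (Π j, Fin (Nat.card {k // (⟨j, k⟩ : Σ j, Fin (e j)) ∈ S}) → O j) :=
    { toFun := fun x j k => x.1 ⟨j, ((ε j).symm k).1⟩
      map_add' := fun _ _ => rfl
      map_smul' := fun _ _ => rfl }
  refine ⟨LinearEquiv.ofBijective F ⟨?_, fun y => ?_⟩⟩
  · rw [injective_iff_map_eq_zero]
    intro x hx
    ext ⟨j, k⟩
    by_cases hk : (⟨j, k⟩ : Σ j, Fin (e j)) ∈ S
    · have h : x.1 ⟨j, ((ε j).symm (ε j ⟨k, hk⟩)).1⟩ = 0 := congrFun (congrFun hx j) (ε j ⟨k, hk⟩)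
      rwa [Equiv.symm_apply_apply] at h
    · exact x.2 _ hk
  · refine ⟨⟨fun i => if h : i ∈ S then y i.1 (ε i.1 ⟨i.2, h⟩) else 0, fun i hi => ?_⟩, ?_⟩
    · simpa using fun h => absurd h hi
    · ext j k
      change dite _ _ _ = _
      rw [dif_pos ((ε j).symm k).2]
      simp

/-- Let `Λ = ℤ_p[[T]]` and `P_j = Φ_{p^j}(1+T)`.  If a finitely generated `Λ`-module `M`
admits a `Λ`-homomorphism to `⊕_{j=0}^n (Λ/(P_j))^{e_j}` with finite kernel and cokernel,
and `π : M → Q` is a surjective `Λ`-homomorphism, then there are `s_j ≤ e_j` and a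
`Λ`-homomorphism `Q → ⊕_{j=0}^n (Λ/(P_j))^{s_j}` with finite kernel and cokernel. -/
theorem quotient_pseudo_isomorphic_to_sub_sum (p : ℕ) [Fact p.Prime] (n : ℕ)
    (e : Fin (n + 1) → ℕ)
    (M Q : Type) [AddCommGroup M] [Module (PowerSeries ℤ_[p]) M]
    [Module.Finite (PowerSeries ℤ_[p]) M]
    [AddCommGroup Q] [Module (PowerSeries ℤ_[p]) Q]
    (ψ : M →ₗ[PowerSeries ℤ_[p]]
      (Π j : Fin (n + 1), Fin (e j) →
        PowerSeries ℤ_[p] ⧸ Ideal.span {Polynomial.aeval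
          (1 + PowerSeries.X : PowerSeries ℤ_[p]) (Polynomial.cyclotomic (p ^ (j : ℕ)) ℤ_[p])}))
    (hψker : Finite (LinearMap.ker ψ))
    (hψcoker : Finite ((Π j : Fin (n + 1), Fin (e j) →
        PowerSeries ℤ_[p] ⧸ Ideal.span {Polynomial.aeval
          (1 + PowerSeries.X : PowerSeries ℤ_[p]) (Polynomial.cyclotomic (p ^ (j : ℕ)) ℤ_[p])})
      ⧸ LinearMap.range ψ))
    (π : M →ₗ[PowerSeries ℤ_[p]] Q) (hπ : Function.Surjective π) :
    ∃ s : Fin (n + 1) → ℕ, (∀ j, s j ≤ e j) ∧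
      ∃ g : Q →ₗ[PowerSeries ℤ_[p]]
        (Π j : Fin (n + 1), Fin (s j) →
          PowerSeries ℤ_[p] ⧸ Ideal.span {Polynomial.aeval
            (1 + PowerSeries.X : PowerSeries ℤ_[p])
            (Polynomial.cyclotomic (p ^ (j : ℕ)) ℤ_[p])}),
        Finite (LinearMap.ker g) ∧
        Finite ((Π j : Fin (n + 1), Fin (s j) →
          PowerSeries ℤ_[p] ⧸ Ideal.span {Polynomial.aeval
            (1 + PowerSeries.X : PowerSeries ℤ_[p])
            (Polynomial.cyclotomic (p ^ (j : ℕ)) ℤ_[p])})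
          ⧸ LinearMap.range g) := by
  have hprime := fun j => (isPrime_and_finite_quotient_span_aeval_cyclotomic p j).1
  have hfin := fun j => (isPrime_and_finite_quotient_span_aeval_cyclotomic p j).2
  let P : ℕ → Ideal (PowerSeries ℤ_[p]) := fun j => Ideal.span {Polynomial.aeval
    (1 + PowerSeries.X : PowerSeries ℤ_[p]) (Polynomial.cyclotomic (p ^ j) ℤ_[p])}
  let _ : Module ℤ_[p] M := Module.compHom M (algebraMap ℤ_[p] (PowerSeries ℤ_[p]))
  have : IsScalarTower ℤ_[p] (PowerSeries ℤ_[p]) M := IsScalarTower.of_compHom _ _ _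
  let _ : Module ℤ_[p] Q := Module.compHom Q (algebraMap ℤ_[p] (PowerSeries ℤ_[p]))
  have : IsScalarTower ℤ_[p] (PowerSeries ℤ_[p]) Q := IsScalarTower.of_compHom _ _ _
  have : Module.Finite ℤ_[p] M := by
    have : Finite (LinearMap.ker (ψ.restrictScalars ℤ_[p])) := hψker
    have : Module.Finite ℤ_[p] (M ⧸ LinearMap.ker (ψ.restrictScalars ℤ_[p])) :=
      Module.Finite.equiv (ψ.restrictScalars ℤ_[p]).quotKerEquivRange.symm
    exact Module.Finite.of_submodule_quotient (LinearMap.ker (ψ.restrictScalars ℤ_[p]))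
  have : Module.Finite ℤ_[p] Q := Module.Finite.of_surjective (π.restrictScalars ℤ_[p]) hπ
  obtain ⟨m, hm, hψ⟩ := LinearMap.IsIsogenyBy.of_finite (f := ψ)
  obtain ⟨φ, hφ⟩ := hψ.exists_isIsogenyBy
  let κ := LinearEquiv.piCurry (PowerSeries ℤ_[p])
    (fun (j : Fin (n + 1)) (_ : Fin (e j)) => PowerSeries ℤ_[p] ⧸ P j)
  obtain ⟨S, r, hr, g, hg⟩ := exists_isIsogenyBy_supportedIn (R := ℤ_[p])
    (fun i : Σ j : Fin (n + 1), Fin (e j) => P i.1) (π ∘ₗ φ ∘ₗ κ.toLinearMap)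
    (c := (m : ℤ_[p]) * m) (mul_self_ne_zero.2 (Nat.cast_ne_zero.2 hm)) fun q => by
      obtain ⟨x, rfl⟩ := hπ q
      obtain ⟨y, hy⟩ := hφ.exists_eq_smul x
      exact ⟨κ.symm y, by simp [hy]⟩
  obtain ⟨ε⟩ := nonempty_supportedIn_sigma_linearEquiv (A := PowerSeries ℤ_[p])
    (fun j : Fin (n + 1) => PowerSeries ℤ_[p] ⧸ P j) S
  refine ⟨_, fun j => ?_, ε.toLinearMap ∘ₗ g, (hg.linearEquiv_comp ε).finite_ker_and_coker hr⟩
  simpa using Nat.card_le_card_of_injective _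
    (Subtype.val_injective (p := fun k => (⟨j, k⟩ : Σ j : Fin (n + 1), Fin (e j)) ∈ S))
end

section
/- Let p be a prime, Λ = ℤ_p[[T]] the power series ring over the p-adic integers, and for j ≥ 0 let P_j = Φ_{p^j}(1+T) ∈ Λ be the image of the p^j-th cyclotomic polynomial under X ↦ 1+T. Let n ≥ 0 and let a_j, e_j, s_j (0 ≤ j ≤ n) be nonnegative integers. Suppose L → M → Q → 0 is an exact sequence of Λ-modules, and suppose there are Λ-module homomorphisms with finite kernel and finite cokernel from L to ⊕_{j=0}^{n}(Λ/(P_j))^{a_j}, from M to ⊕_{j=0}^{n}(Λ/(P_j))^{e_j}, and from Q to ⊕_{j=0}^{n}(Λ/(P_j))^{s_j}. Then s_j ≥ e_j − a_j for every 0 ≤ j ≤ n. -/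
set_option synthInstance.maxHeartbeats 1000000
set_option maxHeartbeats 1000000

section BaseChange

open TensorProduct

variable {R K : Type*} [CommRing R] [Field K] [Algebra R K]

/-- If multiplication by `r` kills the kernel of `φ` and multiplication by `s` kills its cokernel,
then `φ` is invertible up to multiplication by `r * s`. -/
theorem LinearMap.exists_quasiInverse {L E : Type*} [AddCommGroup L] [Module R L]
    [AddCommGroup E] [Module R E] (φ : L →ₗ[R] E) {r s : R}
    (hr : ∀ x, φ x = 0 → r • x = 0) (hs : ∀ y, ∃ x, φ x = s • y) :
    ∃ ψ : E →ₗ[R] L, (∀ x, ψ (φ x) = (r * s) • x) ∧ ∀ y, φ (ψ y) = (r * s) • y := by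
  choose c hc using hs
  have key : ∀ x x', φ x = φ x' → r • x = r • x' := fun x x' h ↦ by
    rw [← sub_eq_zero, ← smul_sub]
    exact hr _ (by rw [map_sub, h, sub_self])
  refine ⟨⟨⟨fun y ↦ r • c y, fun y z ↦ ?_⟩, fun t y ↦ ?_⟩, fun x ↦ ?_, fun y ↦ ?_⟩
  · rw [← smul_add]
    exact key _ _ (by simp [hc])
  · simp only [RingHom.id_apply]
    rw [smul_comm t r]
    exact key _ _ (by simp [hc, smul_comm t s])
  · change r • c (φ x) = _
    rw [mul_smul]
    exact key _ _ (by simp [hc])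
  · change φ (r • c y) = _
    rw [map_smul, hc, mul_smul]

/-- A pseudo-isomorphism becomes an isomorphism after base change to a field of
characteristic zero. -/
theorem LinearMap.nonempty_baseChange_equiv_of_finite [CharZero K] {L E : Type*}
    [AddCommGroup L] [Module R L] [AddCommGroup E] [Module R E] (φ : L →ₗ[R] E)
    (hker : Finite (LinearMap.ker φ)) (hcoker : Finite (E ⧸ LinearMap.range φ)) :
    Nonempty ((K ⊗[R] L) ≃ₗ[K] (K ⊗[R] E)) := by
  obtain ⟨ψ, h₁, h₂⟩ := φ.exists_quasiInverse
    (r := (Nat.card (LinearMap.ker φ) : R)) (s := (Nat.card (E ⧸ LinearMap.range φ) : R))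
    (fun x hx ↦ by
      rw [Nat.cast_smul_eq_nsmul]
      exact congrArg Subtype.val (card_nsmul_eq_zero' (x := (⟨x, hx⟩ : LinearMap.ker φ))))
    (fun y ↦ by
      have h : Nat.card (E ⧸ LinearMap.range φ) • (LinearMap.range φ).mkQ y = 0 :=
        card_nsmul_eq_zero'
      rwa [← map_nsmul, Submodule.mkQ_apply, Submodule.Quotient.mk_eq_zero,
        ← Nat.cast_smul_eq_nsmul R] at h)
  set N : ℕ := Nat.card (LinearMap.ker φ) * Nat.card (E ⧸ LinearMap.range φ) with hN
  have hN0 : (N : K) ≠ 0 := Nat.cast_ne_zero.mpr (mul_ne_zero Nat.card_pos.ne' Nat.card_pos.ne')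
  have e₁ : ψ ∘ₗ φ = (N : R) • LinearMap.id := by
    ext x
    simpa [hN] using h₁ x
  have e₂ : φ ∘ₗ ψ = (N : R) • LinearMap.id := by
    ext x
    simpa [hN] using h₂ x
  have f₁ : ψ.baseChange K ∘ₗ φ.baseChange K = (N : K) • LinearMap.id := by
    rw [← LinearMap.baseChange_comp, e₁, LinearMap.baseChange_smul, LinearMap.baseChange_id]
    ext x
    simp [Nat.cast_smul_eq_nsmul]
  have f₂ : φ.baseChange K ∘ₗ ψ.baseChange K = (N : K) • LinearMap.id := by
    rw [← LinearMap.baseChange_comp, e₂, LinearMap.baseChange_smul, LinearMap.baseChange_id]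
    ext x
    simp [Nat.cast_smul_eq_nsmul]
  refine ⟨LinearEquiv.ofLinearMap (φ.baseChange K) ((N : K)⁻¹ • ψ.baseChange K) ?_ ?_⟩
  · rw [LinearMap.comp_smul, f₂, smul_smul, inv_mul_cancel₀ hN0, one_smul]
  · rw [LinearMap.smul_comp, f₁, smul_smul, inv_mul_cancel₀ hN0, one_smul]

/-- Base change of a cyclic module to a field in which the relation becomes zero. -/
theorem nonempty_baseChange_quotient_span_equiv {P : R} (hP : algebraMap R K P = 0) :
    Nonempty ((K ⊗[R] (R ⧸ Ideal.span {P})) ≃ₗ[K] K) := by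
  have h : (Ideal.span {P}).map (algebraMap R K) = ⊥ := by
    rw [Ideal.map_span, Set.image_singleton, hP, Ideal.span_singleton_eq_bot]
  exact ⟨(Algebra.TensorProduct.quotIdealMapEquivTensorQuot K
    (Ideal.span {P})).symm.toLinearEquiv.trans (Submodule.quotEquivOfEqBot _ h)⟩

/-- Base change of a cyclic module to a field in which the relation becomes invertible. -/
theorem subsingleton_baseChange_quotient_span {P : R} (hP : algebraMap R K P ≠ 0) :
    Subsingleton (K ⊗[R] (R ⧸ Ideal.span {P})) := by
  have h : (Ideal.span {P}).map (algebraMap R K) = ⊤ := by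
    rw [Ideal.map_span, Set.image_singleton, Ideal.span_singleton_eq_top]
    exact hP.isUnit
  have := Ideal.Quotient.subsingleton_iff.mpr h
  exact (Algebra.TensorProduct.quotIdealMapEquivTensorQuot K
    (Ideal.span {P})).symm.toEquiv.subsingleton

/-- Base change to a field killing `P j` and no other `P i` picks out the multiplicity of
`R ⧸ (P j)` in a direct sum of such cyclic modules. -/
theorem finrank_baseChange_pi_quotient_span {ι : Type*} [Fintype ι] [DecidableEq ι]
    (P : ι → R) (j : ι) (hj : algebraMap R K (P j) = 0)
    (hi : ∀ i, i ≠ j → algebraMap R K (P i) ≠ 0) (a : ι → ℕ) :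
    Module.Finite K (K ⊗[R] (Π i, Fin (a i) → R ⧸ Ideal.span {P i})) ∧
      Module.finrank K (K ⊗[R] (Π i, Fin (a i) → R ⧸ Ideal.span {P i})) = a j := by
  let e₁ := TensorProduct.piRight R K K (fun i ↦ Fin (a i) → R ⧸ Ideal.span {P i})
  let e₂ : (Π i, K ⊗[R] (Fin (a i) → R ⧸ Ideal.span {P i})) ≃ₗ[K]
      (Π i, Fin (a i) → K ⊗[R] (R ⧸ Ideal.span {P i})) :=
    LinearEquiv.piCongrRight fun i ↦
      TensorProduct.piRight R K K (fun _ : Fin (a i) ↦ R ⧸ Ideal.span {P i})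
  let e := e₁.trans e₂
  obtain ⟨k⟩ := nonempty_baseChange_quotient_span_equiv hj
  have hfin : ∀ i, Module.Finite K (K ⊗[R] (R ⧸ Ideal.span {P i})) := fun i ↦ by
    rcases eq_or_ne i j with rfl | h
    · exact Module.Finite.equiv k.symm
    · have := subsingleton_baseChange_quotient_span (hi i h)
      infer_instance
  refine ⟨Module.Finite.equiv e.symm, ?_⟩
  rw [e.finrank_eq, Module.finrank_pi_fintype, Finset.sum_eq_single j]
  · rw [Module.finrank_pi_fintype]
    simp [k.finrank_eq]
  · intro i _ h
    have := subsingleton_baseChange_quotient_span (hi i h)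
    exact Module.finrank_zero_of_subsingleton
  · simp

/-- Base change to a field is subadditive in dimension along right exact sequences. -/
theorem finrank_baseChange_le_add {L M Q : Type*} [AddCommGroup L] [Module R L]
    [AddCommGroup M] [Module R M] [AddCommGroup Q] [Module R Q]
    (f : L →ₗ[R] M) (g : M →ₗ[R] Q) (hfg : LinearMap.range f = LinearMap.ker g)
    (hg : Function.Surjective g) [Module.Finite K (K ⊗[R] L)] [Module.Finite K (K ⊗[R] M)]
    [Module.Finite K (K ⊗[R] Q)] :
    Module.finrank K (K ⊗[R] M) ≤
      Module.finrank K (K ⊗[R] L) + Module.finrank K (K ⊗[R] Q) := by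
  have hex : Function.Exact (f.baseChange K) (g.baseChange K) := by
    rw [LinearMap.baseChange_eq_ltensor, LinearMap.baseChange_eq_ltensor]
    exact lTensor_exact K (LinearMap.exact_iff.mpr hfg.symm) hg
  have h := (g.baseChange K).finrank_range_add_finrank_ker
  rw [hex.linearMap_ker_eq] at h
  have h₁ := (f.baseChange K).finrank_range_le
  have h₂ := (LinearMap.range (g.baseChange K)).finrank_le
  omega

end BaseChange

section Cyclotomic

open Polynomial

variable (p : ℕ) [Fact p.Prime]

theorem PadicInt.natCast_dvd_of_map_toZMod_eq_zero {g : PowerSeries ℤ_[p]}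
    (hg : PowerSeries.map PadicInt.toZMod g = 0) : (p : PowerSeries ℤ_[p]) ∣ g := by
  have h : ∀ n, ∃ c : ℤ_[p], PowerSeries.coeff n g = p * c := fun n ↦ by
    have hn : PowerSeries.coeff n g ∈ RingHom.ker (PadicInt.toZMod (p := p)) := by
      rw [RingHom.mem_ker, ← PowerSeries.coeff_map, hg, map_zero]
    rwa [PadicInt.ker_toZMod, PadicInt.maximalIdeal_eq_span_p, Ideal.mem_span_singleton] at hn
  choose c hc using h
  refine ⟨PowerSeries.mk c, ?_⟩
  ext n
  rw [hc, ← map_natCast (PowerSeries.C (R := ℤ_[p])) p, PowerSeries.coeff_C_mul,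
    PowerSeries.coeff_mk]

/-- The image of a polynomial under `X ↦ 1 + X` in power series. -/
theorem aeval_one_add_X_eq_coe_comp {A : Type*} [CommRing A] (F : A[X]) :
    aeval (1 + PowerSeries.X : PowerSeries A) F = ((F.comp (1 + X) : A[X]) : PowerSeries A) := by
  rw [comp, ← coeToPowerSeries.ringHom_apply, hom_eval₂, aeval_def]
  congr 1
  · ext; simp
  · simp

/-- `Φ_{p^j}(1 + T)` does not divide any power of `p`. -/
theorem not_aeval_cyclotomic_dvd_pow (j k : ℕ) :
    ¬ aeval (1 + PowerSeries.X : PowerSeries ℤ_[p]) (cyclotomic (p ^ j) ℤ_[p]) ∣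
      (p : PowerSeries ℤ_[p]) ^ k := by
  have hp : (p : PowerSeries ℤ_[p]) ≠ 0 := by
    rw [← map_natCast (PowerSeries.C (R := ℤ_[p])) p, ne_eq,
      map_eq_zero_iff _ PowerSeries.C_injective]
    exact PadicInt.prime_p.ne_zero
  induction k with
  | zero =>
    rw [pow_zero, ← isUnit_iff_dvd_one, aeval_one_add_X_eq_coe_comp]
    intro h
    have h' := h.map (PowerSeries.constantCoeff (R := ℤ_[p]))
    rw [← PowerSeries.coeff_zero_eq_constantCoeff_apply, coeff_coe, coeff_zero_eq_eval_zero,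
      eval_comp] at h'
    simp only [eval_add, eval_one, eval_X, add_zero] at h'
    rcases j with _ | j
    · simp at h'
    · rw [eval_one_cyclotomic_prime_pow] at h'
      exact PadicInt.prime_p.not_isUnit h'
  | succ k ih =>
    rintro ⟨g, hg⟩
    have h := congrArg (PowerSeries.map (PadicInt.toZMod (p := p))) hg
    rw [pow_succ, map_mul, map_mul, map_natCast, ← map_natCast (PowerSeries.C (R := ZMod p)) p,
      CharP.cast_eq_zero (ZMod p) p, map_zero, mul_zero, eq_comm, mul_eq_zero] at h
    rcases h with h | h
    · rw [aeval_one_add_X_eq_coe_comp, ← polynomial_map_coe, coe_eq_zero_iff] at h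
      refine ((Monic.comp (cyclotomic.monic (p ^ j) ℤ_[p]) (q := 1 + X) ?_ ?_).map
        (PadicInt.toZMod (p := p))).ne_zero h
      · rw [add_comm]; exact monic_X_add_C 1
      · rw [add_comm, ← C_1, natDegree_X_add_C]; exact one_ne_zero
    · obtain ⟨g', rfl⟩ := PadicInt.natCast_dvd_of_map_toZMod_eq_zero p h
      refine ih ⟨g', mul_right_cancel₀ hp ?_⟩
      rw [← pow_succ, hg]
      ring

/-- There is a field of characteristic zero over `ℤ_p[[T]]` in which `Φ_{p^j}(1 + T)` vanishes. -/
theorem exists_field_aeval_cyclotomic_eq_zero (j : ℕ) :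
    ∃ (K : Type) (_ : Field K) (_ : CharZero K) (_ : Algebra (PowerSeries ℤ_[p]) K),
      algebraMap (PowerSeries ℤ_[p]) K
        (aeval (1 + PowerSeries.X : PowerSeries ℤ_[p]) (cyclotomic (p ^ j) ℤ_[p])) = 0 := by
  set P := aeval (1 + PowerSeries.X : PowerSeries ℤ_[p]) (cyclotomic (p ^ j) ℤ_[p])
  obtain ⟨q, hq, hPq, hdisj⟩ := Ideal.exists_le_prime_disjoint (Ideal.span {P})
    (Submonoid.powers (p : PowerSeries ℤ_[p])) (by
      rw [Set.disjoint_left]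
      rintro _ hx ⟨k, rfl⟩
      exact not_aeval_cyclotomic_dvd_pow p j k (Ideal.mem_span_singleton.mp hx))
  let π : PowerSeries ℤ_[p] →+* FractionRing (PowerSeries ℤ_[p] ⧸ q) :=
    (algebraMap (PowerSeries ℤ_[p] ⧸ q) _).comp (Ideal.Quotient.mk q)
  have hπ : ∀ x, π x = 0 ↔ x ∈ q := fun x ↦ by
    rw [RingHom.comp_apply, map_eq_zero_iff _ (IsFractionRing.injective _ _),
      Ideal.Quotient.eq_zero_iff_mem]
  have hp : π p ≠ 0 := fun h ↦
    Set.disjoint_left.mp hdisj ((hπ _).mp h) (Submonoid.mem_powers _)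
  refine ⟨FractionRing (PowerSeries ℤ_[p] ⧸ q), inferInstance, ?_, π.toAlgebra,
    (hπ P).mpr (hPq (Ideal.mem_span_singleton_self P))⟩
  refine charZero_of_inj_zero fun m hm ↦ ?_
  by_contra hm0
  have hm0' : (m : ℤ_[p]) ≠ 0 := Nat.cast_ne_zero.mpr hm0
  have h : (π.comp PowerSeries.C) (m : ℤ_[p]) = 0 := by rw [map_natCast, hm]
  rw [PadicInt.unitCoeff_spec hm0', map_mul, map_pow, mul_eq_zero] at h
  rcases h with h | h
  · exact ((PadicInt.unitCoeff hm0').isUnit.map (π.comp PowerSeries.C)).ne_zero h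
  · rw [map_natCast, ← map_natCast π] at h
    exact hp (eq_zero_of_pow_eq_zero h)

/-- In characteristic zero, the cyclotomic elements `Φ_{p^i}(1 + T)` have no common zero. -/
theorem eq_of_algebraMap_aeval_cyclotomic_eq_zero {K : Type*} [Field K] [CharZero K]
    [Algebra (PowerSeries ℤ_[p]) K] {i j : ℕ}
    (hi : algebraMap (PowerSeries ℤ_[p]) K
      (aeval (1 + PowerSeries.X : PowerSeries ℤ_[p]) (cyclotomic (p ^ i) ℤ_[p])) = 0)
    (hj : algebraMap (PowerSeries ℤ_[p]) K
      (aeval (1 + PowerSeries.X : PowerSeries ℤ_[p]) (cyclotomic (p ^ j) ℤ_[p])) = 0) :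
    i = j := by
  have hp : p.Prime := Fact.out
  have key : ∀ k : ℕ, algebraMap (PowerSeries ℤ_[p]) K
      (aeval (1 + PowerSeries.X : PowerSeries ℤ_[p]) (cyclotomic (p ^ k) ℤ_[p])) = 0 →
      IsPrimitiveRoot (algebraMap (PowerSeries ℤ_[p]) K (1 + PowerSeries.X)) (p ^ k) := by
    intro k hk
    have : NeZero ((p ^ k : ℕ) : K) := ⟨Nat.cast_ne_zero.mpr (pow_pos hp.pos k).ne'⟩
    rwa [aeval_def, hom_eval₂, ← eval_map, map_cyclotomic, ← IsRoot.def,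
      isRoot_cyclotomic_iff] at hk
  exact Nat.pow_right_injective hp.two_le ((key i hi).unique (key j hj))

end Cyclotomic

/-- Let `Λ = ℤ_p[[T]]` and `P_j = Φ_{p^j}(1+T)`.  Given an exact sequence
`L → M → Q → 0` of `Λ`-modules and pseudo-isomorphisms (maps with finite kernel and
cokernel) from `L`, `M`, `Q` to `⊕_{j=0}^n (Λ/(P_j))^{a_j}`, `⊕_{j=0}^n (Λ/(P_j))^{e_j}`,
`⊕_{j=0}^n (Λ/(P_j))^{s_j}` respectively, one has `s_j ≥ e_j - a_j` for all `j`. -/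
theorem multiplicity_lower_bound_of_exact (p : ℕ) [Fact p.Prime] (n : ℕ)
    (a e s : Fin (n + 1) → ℕ)
    (L M Q : Type)
    [AddCommGroup L] [Module (PowerSeries ℤ_[p]) L]
    [AddCommGroup M] [Module (PowerSeries ℤ_[p]) M]
    [AddCommGroup Q] [Module (PowerSeries ℤ_[p]) Q]
    (f : L →ₗ[PowerSeries ℤ_[p]] M) (g : M →ₗ[PowerSeries ℤ_[p]] Q)
    (hexact : LinearMap.range f = LinearMap.ker g) (hg : Function.Surjective g)
    (φL : L →ₗ[PowerSeries ℤ_[p]]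
      (Π j : Fin (n + 1), Fin (a j) →
        PowerSeries ℤ_[p] ⧸ Ideal.span {Polynomial.aeval
          (1 + PowerSeries.X : PowerSeries ℤ_[p]) (Polynomial.cyclotomic (p ^ (j : ℕ)) ℤ_[p])}))
    (hφLker : Finite (LinearMap.ker φL))
    (hφLcoker : Finite ((Π j : Fin (n + 1), Fin (a j) →
        PowerSeries ℤ_[p] ⧸ Ideal.span {Polynomial.aeval
          (1 + PowerSeries.X : PowerSeries ℤ_[p]) (Polynomial.cyclotomic (p ^ (j : ℕ)) ℤ_[p])})
      ⧸ LinearMap.range φL))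
    (φM : M →ₗ[PowerSeries ℤ_[p]]
      (Π j : Fin (n + 1), Fin (e j) →
        PowerSeries ℤ_[p] ⧸ Ideal.span {Polynomial.aeval
          (1 + PowerSeries.X : PowerSeries ℤ_[p]) (Polynomial.cyclotomic (p ^ (j : ℕ)) ℤ_[p])}))
    (hφMker : Finite (LinearMap.ker φM))
    (hφMcoker : Finite ((Π j : Fin (n + 1), Fin (e j) →
        PowerSeries ℤ_[p] ⧸ Ideal.span {Polynomial.aeval
          (1 + PowerSeries.X : PowerSeries ℤ_[p]) (Polynomial.cyclotomic (p ^ (j : ℕ)) ℤ_[p])})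
      ⧸ LinearMap.range φM))
    (φQ : Q →ₗ[PowerSeries ℤ_[p]]
      (Π j : Fin (n + 1), Fin (s j) →
        PowerSeries ℤ_[p] ⧸ Ideal.span {Polynomial.aeval
          (1 + PowerSeries.X : PowerSeries ℤ_[p]) (Polynomial.cyclotomic (p ^ (j : ℕ)) ℤ_[p])}))
    (hφQker : Finite (LinearMap.ker φQ))
    (hφQcoker : Finite ((Π j : Fin (n + 1), Fin (s j) →
        PowerSeries ℤ_[p] ⧸ Ideal.span {Polynomial.aeval
          (1 + PowerSeries.X : PowerSeries ℤ_[p]) (Polynomial.cyclotomic (p ^ (j : ℕ)) ℤ_[p])})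
      ⧸ LinearMap.range φQ)) :
    ∀ j : Fin (n + 1), (e j : ℤ) - (a j : ℤ) ≤ (s j : ℤ) := by
  intro j
  let P : Fin (n + 1) → PowerSeries ℤ_[p] := fun i ↦ Polynomial.aeval
    (1 + PowerSeries.X : PowerSeries ℤ_[p]) (Polynomial.cyclotomic (p ^ (i : ℕ)) ℤ_[p])
  obtain ⟨K, _, _, _, hj⟩ := exists_field_aeval_cyclotomic_eq_zero p j
  have hi : ∀ i, i ≠ j → algebraMap (PowerSeries ℤ_[p]) K (P i) ≠ 0 := fun i hij h ↦
    hij (Fin.ext (eq_of_algebraMap_aeval_cyclotomic_eq_zero p h hj))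
  obtain ⟨eL⟩ := φL.nonempty_baseChange_equiv_of_finite (K := K) hφLker hφLcoker
  obtain ⟨eM⟩ := φM.nonempty_baseChange_equiv_of_finite (K := K) hφMker hφMcoker
  obtain ⟨eQ⟩ := φQ.nonempty_baseChange_equiv_of_finite (K := K) hφQker hφQcoker
  obtain ⟨_, ha⟩ := finrank_baseChange_pi_quotient_span P j hj hi a
  obtain ⟨_, he⟩ := finrank_baseChange_pi_quotient_span P j hj hi e
  obtain ⟨_, hs⟩ := finrank_baseChange_pi_quotient_span P j hj hi s
  have := Module.Finite.equiv eL.symm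
  have := Module.Finite.equiv eM.symm
  have := Module.Finite.equiv eQ.symm
  have h := finrank_baseChange_le_add (K := K) f g hexact hg
  have hM := eM.finrank_eq.trans he
  have hL := eL.finrank_eq.trans ha
  have hQ := eQ.finrank_eq.trans hs
  omega
end
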